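/- In the standing setup, the following conditions are equivalent: (i) R commutes with ζ⊗ζ; (ii) Y' = Y; (iii) Y' = c·Y for some c ∈ k; (iv) there is c ∈ k such that ℓ'_{xy} = c·ℓ_{xy} for all x,y ∈ V; (v) ℓ_{xy} ∧ ℓ'_{xy} = 0 for all x,y ∈ V (i.e., ℓ_{xy}(u)ℓ'_{xy}(v) = ℓ_{xy}(v)ℓ'_{xy}(u) for all u,v ∈ V). -/

import Mathlib

open TensorProduct LinearMap

noncomputable section

variable (k V : Type) [Field k] [AddCommGroup V] [Module k V]

/-- `R ⊗ Id` acting on `V ⊗ (V ⊗ V)`. -/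
def op12 (R : V ⊗[k] V →ₗ[k] V ⊗[k] V) :
    V ⊗[k] (V ⊗[k] V) →ₗ[k] V ⊗[k] (V ⊗[k] V) :=
  (TensorProduct.assoc k V V V).toLinearMap ∘ₗ LinearMap.rTensor V R ∘ₗ
    (TensorProduct.assoc k V V V).symm.toLinearMap

/-- `Id ⊗ R` acting on `V ⊗ (V ⊗ V)`. -/
def op23 (R : V ⊗[k] V →ₗ[k] V ⊗[k] V) :
    V ⊗[k] (V ⊗[k] V) →ₗ[k] V ⊗[k] (V ⊗[k] V) :=
  LinearMap.lTensor V R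

/-- A Hecke symmetry with parameter `q`: an operator on `V ⊗ V` satisfying the braid
equation and the Hecke relation `(R - q·Id)(R + Id) = 0`, with `q ≠ 0`. -/
def IsHeckeSymmetry (q : k) (R : V ⊗[k] V →ₗ[k] V ⊗[k] V) : Prop :=
  q ≠ 0 ∧
    op12 k V R ∘ₗ op23 k V R ∘ₗ op12 k V R = op23 k V R ∘ₗ op12 k V R ∘ₗ op23 k V R ∧
    (R - q • LinearMap.id) ∘ₗ (R + LinearMap.id) = 0

/-- `x ⋏ y = ζ(x) ⊗ y - ζ(y) ⊗ x`. -/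
def wedge2 (ζ : V ≃ₗ[k] V) (x y : V) : V ⊗[k] V := ζ x ⊗ₜ[k] y - ζ y ⊗ₜ[k] x

/-- `Υ²`, the span of the tensors `x ⋏ y`. -/
def Ups2 (ζ : V ≃ₗ[k] V) : Submodule k (V ⊗[k] V) :=
  Submodule.span k {w : V ⊗[k] V | ∃ x y : V, w = wedge2 k V ζ x y}

/-- `x ⋏ y ⋏ z`. -/
def wedge3 (ζ : V ≃ₗ[k] V) (x y z : V) : V ⊗[k] (V ⊗[k] V) :=
  ζ (ζ x) ⊗ₜ[k] (ζ y ⊗ₜ[k] z) + ζ (ζ y) ⊗ₜ[k] (ζ z ⊗ₜ[k] x) + ζ (ζ z) ⊗ₜ[k] (ζ x ⊗ₜ[k] y)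
    - ζ (ζ x) ⊗ₜ[k] (ζ z ⊗ₜ[k] y) - ζ (ζ y) ⊗ₜ[k] (ζ x ⊗ₜ[k] z) - ζ (ζ z) ⊗ₜ[k] (ζ y ⊗ₜ[k] x)

/-- `Υ³`, the span of the tensors `x ⋏ y ⋏ z` (which coincides with
`(V ⊗ Υ²) ∩ (Υ² ⊗ V)`). -/
def Ups3 (ζ : V ≃ₗ[k] V) : Submodule k (V ⊗[k] (V ⊗[k] V)) :=
  Submodule.span k {t : V ⊗[k] (V ⊗[k] V) | ∃ x y z : V, t = wedge3 k V ζ x y z}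

/-- The bilinear extension `w ↦ x ⋏ w` of the wedge multiplication `V × Υ² → Υ³`:
on elements of `Υ²` it satisfies `x ⋏ (y ⋏ z) = x ⋏ y ⋏ z`. -/
def wedge31 (ζ : V ≃ₗ[k] V) (x : V) : V ⊗[k] V →ₗ[k] V ⊗[k] (V ⊗[k] V) :=
  TensorProduct.mk k V (V ⊗[k] V) (ζ (ζ x)) +
    (TensorProduct.assoc k V V V).toLinearMap ∘ₗ
      ((TensorProduct.mk k (V ⊗[k] V) V).flip x ∘ₗ
        TensorProduct.map ζ.toLinearMap ζ.toLinearMap) -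
    TensorProduct.map ζ.toLinearMap (TensorProduct.mk k V V (ζ x))

/-- The skewsymmetrizer `Y = q·Id - R`. -/
def skewY (q : k) (R : V ⊗[k] V →ₗ[k] V ⊗[k] V) : V ⊗[k] V →ₗ[k] V ⊗[k] V :=
  q • LinearMap.id - R

/-- `R' = (ζ⁻¹ ⊗ ζ⁻¹) ∘ R ∘ (ζ ⊗ ζ)`. -/
def Rprime (ζ : V ≃ₗ[k] V) (R : V ⊗[k] V →ₗ[k] V ⊗[k] V) :
    V ⊗[k] V →ₗ[k] V ⊗[k] V :=
  TensorProduct.map ζ.symm.toLinearMap ζ.symm.toLinearMap ∘ₗ R ∘ₗ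
    TensorProduct.map ζ.toLinearMap ζ.toLinearMap

/-- `ℓ_{xy}(z) = ω̃(x ⋏ Y(ζ(y) ⊗ z))`, where `Ω` is a linear extension of `ω̃` to
`V ⊗ V ⊗ V`. -/
def ell (ζ : V ≃ₗ[k] V) (Y : V ⊗[k] V →ₗ[k] V ⊗[k] V)
    (Ω : V ⊗[k] (V ⊗[k] V) →ₗ[k] k) (x y : V) : Module.Dual k V :=
  Ω ∘ₗ wedge31 k V ζ x ∘ₗ Y ∘ₗ TensorProduct.mk k V V (ζ y)

/-- The linear forms `ℓ_{xy}` associated with the Hecke symmetry `R`. -/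
def ellF (ζ : V ≃ₗ[k] V) (q : k) (R : V ⊗[k] V →ₗ[k] V ⊗[k] V)
    (Ω : V ⊗[k] (V ⊗[k] V) →ₗ[k] k) (x y : V) : Module.Dual k V :=
  ell k V ζ (skewY k V q R) Ω x y

/-- The linear forms `ℓ'_{xy}` associated with the twisted Hecke symmetry `R'`. -/
def ellF' (ζ : V ≃ₗ[k] V) (q : k) (R : V ⊗[k] V →ₗ[k] V ⊗[k] V)
    (Ω : V ⊗[k] (V ⊗[k] V) →ₗ[k] k) (x y : V) : Module.Dual k V :=
  ell k V ζ (skewY k V q (Rprime k V ζ R)) Ω x y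

section

/-- The alternating tensors of degree two: the span of the tensors `x ⊗ y - y ⊗ x`. -/
def altTwo : Submodule k (V ⊗[k] V) :=
  Submodule.span k {w : V ⊗[k] V | ∃ x y : V, w = x ⊗ₜ[k] y - y ⊗ₜ[k] x}

/-- A pair of operators on `V ⊗ V` with image the alternating tensors, satisfying the relations
of the skewsymmetrizers of a Hecke symmetry, with `N'` acting on the first two tensor factors
and `N` on the last two. -/
structure IsSkewPair (q : k) (N N' : V ⊗[k] V →ₗ[k] V ⊗[k] V) : Prop where
  ne_zero : q ≠ 0
  range_left : LinearMap.range N = altTwo k V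
  range_right : LinearMap.range N' = altTwo k V
  sq_left : N ∘ₗ N = (1 + q) • N
  sq_right : N' ∘ₗ N' = (1 + q) • N'
  braid : ∀ t, op12 k V N' (op23 k V N (op12 k V N' t)) - q • op12 k V N' t =
    op23 k V N (op12 k V N' (op23 k V N t)) - q • op23 k V N t

variable {k V}

@[simp]
theorem op12_tmul (R : V ⊗[k] V →ₗ[k] V ⊗[k] V) (x y z : V) :
    op12 k V R (x ⊗ₜ (y ⊗ₜ z)) = TensorProduct.assoc k V V V (R (x ⊗ₜ y) ⊗ₜ z) := by
  simp [op12]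

@[simp]
theorem op12_assoc (R : V ⊗[k] V →ₗ[k] V ⊗[k] V) (w : V ⊗[k] V) (z : V) :
    op12 k V R (TensorProduct.assoc k V V V (w ⊗ₜ z)) =
      TensorProduct.assoc k V V V (R w ⊗ₜ z) := by
  simp [op12]

@[simp]
theorem op23_tmul (R : V ⊗[k] V →ₗ[k] V ⊗[k] V) (x : V) (w : V ⊗[k] V) :
    op23 k V R (x ⊗ₜ w) = x ⊗ₜ R w := by
  simp [op23]

theorem tmul_sub_tmul_mem_altTwo (x y : V) : x ⊗ₜ[k] y - y ⊗ₜ[k] x ∈ altTwo k V :=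
  Submodule.subset_span ⟨x, y, rfl⟩

/-- Linear maps agreeing on the tensors `x ⊗ y - y ⊗ x` agree on all alternating tensors. -/
theorem eq_of_mem_altTwo {M : Type*} [AddCommGroup M] [Module k M] {f g : V ⊗[k] V →ₗ[k] M}
    (h : ∀ x y : V, f (x ⊗ₜ y - y ⊗ₜ x) = g (x ⊗ₜ y - y ⊗ₜ x)) {w : V ⊗[k] V}
    (hw : w ∈ altTwo k V) : f w = g w := by
  refine LinearMap.eqOn_span (f := f) (g := g) ?_ hw
  rintro _ ⟨x, y, rfl⟩
  exact h x y

/-- Two linear maps into a dual space with pointwise proportional values are proportional, or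
take their values in a common line. -/
theorem proportional_or_common_line {M : Type*} [AddCommGroup M] [Module k M]
    (F G : M →ₗ[k] Module.Dual k V)
    (h : ∀ x u v, F x u * G x v = F x v * G x u) (hF : F ≠ 0) :
    (∃ c : k, G = c • F) ∨
      ∃ (f : Module.Dual k V) (α β : M → k), (∀ x, F x = α x • f) ∧ ∀ x, G x = β x • f := by
  have par : ∀ f g : Module.Dual k V, f ≠ 0 → (∀ u v, f u * g v = f v * g u) →
      ∃ c : k, g = c • f := by
    intro f g hf hfg
    obtain ⟨u, hu⟩ : ∃ u, f u ≠ 0 := by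
      by_contra! hc
      exact hf (LinearMap.ext hc)
    refine ⟨g u / f u, LinearMap.ext fun v => ?_⟩
    simp only [LinearMap.smul_apply, smul_eq_mul]
    field_simp
    linear_combination hfg u v
  obtain ⟨x₀, hx₀⟩ : ∃ x, F x ≠ 0 := by
    by_contra! hc
    exact hF (LinearMap.ext hc)
  obtain ⟨c, hc⟩ := par _ _ hx₀ (h x₀)
  have hH : ∀ y, ∃ b : k, (G - c • F) y = b • F x₀ := by
    intro y
    refine par _ _ hx₀ fun u v => ?_
    have h1 := h (x₀ + y) u v
    have h2 := h x₀ u v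
    have h3 := h y u v
    simp only [map_add, LinearMap.add_apply, LinearMap.sub_apply, LinearMap.smul_apply,
      smul_eq_mul, hc] at h1 h2 h3 ⊢
    linear_combination h1 - h2 - h3
  choose b hb using hH
  by_cases hb0 : ∀ y, b y = 0
  · left
    refine ⟨c, LinearMap.ext fun y => ?_⟩
    have := hb y
    rw [hb0, zero_smul, LinearMap.sub_apply, sub_eq_zero] at this
    exact this
  · push Not at hb0
    obtain ⟨y₀, hy₀⟩ := hb0
    have hHF : ∀ x y u v, F x u * (b y * F x₀ v) + F y u * (b x * F x₀ v) =
        F x v * (b y * F x₀ u) + F y v * (b x * F x₀ u) := by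
      intro x y u v
      have e : ∀ z w, G z w = c * F z w + b z * F x₀ w := by
        intro z w
        have := LinearMap.congr_fun (hb z) w
        simp only [LinearMap.sub_apply, LinearMap.smul_apply, smul_eq_mul] at this
        linear_combination this
      have h1 := h (x + y) u v
      have h2 := h x u v
      have h3 := h y u v
      simp only [map_add, LinearMap.add_apply, e] at h1 h2 h3
      linear_combination h1 - h2 - h3
    have hy : ∀ u v, F y₀ u * F x₀ v = F y₀ v * F x₀ u := by
      intro u v
      have h1 := h y₀ u v
      have e : ∀ w, G y₀ w = c * F y₀ w + b y₀ * F x₀ w := by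
        intro w
        have := LinearMap.congr_fun (hb y₀) w
        simp only [LinearMap.sub_apply, LinearMap.smul_apply, smul_eq_mul] at this
        linear_combination this
      simp only [e] at h1
      refine mul_left_cancel₀ hy₀ ?_
      linear_combination h1
    have hF' : ∀ x, ∃ a : k, F x = a • F x₀ := by
      intro x
      refine par _ _ hx₀ fun u v => mul_left_cancel₀ hy₀ ?_
      linear_combination (-1 : k) * hHF x y₀ u v + b x * hy u v
    choose a ha using hF'
    refine Or.inr ⟨F x₀, a, fun x => c * a x + b x, ha, fun x => ?_⟩
    have := hb x
    rw [LinearMap.sub_apply, sub_eq_iff_eq_add, LinearMap.smul_apply] at this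
    rw [this, add_comm, add_smul, mul_smul, ← ha]

theorem alternating_eq_det (e : Module.Basis (Fin 3) k V) (ω : AlternatingMap k V k (Fin 3))
    (x y z : V) :
    ω ![x, y, z] = ω e * (e.coord 0 x * e.coord 1 y * e.coord 2 z
      - e.coord 0 x * e.coord 2 y * e.coord 1 z - e.coord 1 x * e.coord 0 y * e.coord 2 z
      + e.coord 1 x * e.coord 2 y * e.coord 0 z + e.coord 2 x * e.coord 0 y * e.coord 1 z
      - e.coord 2 x * e.coord 1 y * e.coord 0 z) := by
  conv_lhs => rw [ω.eq_smul_basis_det e]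
  simp only [AlternatingMap.smul_apply, smul_eq_mul, Module.Basis.det_apply,
    Matrix.det_fin_three, Module.Basis.toMatrix_apply, Module.Basis.coord_apply]
  simp only [Matrix.cons_val]
  ring

/-- A nonzero vector is the first member of a basis on which `ω` takes the value one. -/
theorem exists_basis_alternating_eq_one (hdim : Module.finrank k V = 3)
    {ω : AlternatingMap k V k (Fin 3)} (hω : ω ≠ 0) {p : V} (hp : p ≠ 0) :
    ∃ e : Module.Basis (Fin 3) k V, e 0 = p ∧ ω e = 1 := by
  have : Module.Finite k V := Module.finite_of_finrank_eq_succ hdim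
  let b := Module.finBasisOfFinrankEq k V hdim
  have hb : ω b ≠ 0 := by
    intro h
    apply hω
    rw [ω.eq_smul_basis_det b, h, zero_smul]
  obtain ⟨x, y, hxy⟩ : ∃ x y, ω ![p, x, y] ≠ 0 := by
    by_contra! hc
    apply hp
    have h0 := hc (b 1) (b 2)
    have h1 := hc (b 2) (b 0)
    have h2 := hc (b 0) (b 1)
    simp [alternating_eq_det b, hb] at h0 h1 h2
    refine b.ext_elem fun i => ?_
    fin_cases i <;> simp [h0, h1, h2]
  have h1 : ω ![p, x, (ω ![p, x, y])⁻¹ • y] = 1 := by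
    have := ω.map_update_smul ![p, x, y] 2 (ω ![p, x, y])⁻¹ y
    have e1 : ∀ z, Function.update ![p, x, y] 2 z = ![p, x, z] := by
      intro z; ext i; fin_cases i <;> simp
    rw [e1, e1] at this
    rw [this, smul_eq_mul, inv_mul_cancel₀ hxy]
  have hli : LinearIndependent k ![p, x, (ω ![p, x, y])⁻¹ • y] := by
    by_contra hc
    have := ω.map_linearDependent _ hc
    rw [h1] at this
    exact one_ne_zero this
  refine ⟨basisOfLinearIndependentOfCardEqFinrank hli (by simp [hdim]), by simp, ?_⟩
  rw [coe_basisOfLinearIndependentOfCardEqFinrank, h1]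

section Components

variable {e : Module.Basis (Fin 3) k V} {ω : AlternatingMap k V k (Fin 3)}
  {θ : V →ₗ[k] V ⊗[k] V →ₗ[k] k}

theorem dualDistrib_coord_eq (he : ω e = 1)
    (hθ : ∀ p x y, θ p (x ⊗ₜ y - y ⊗ₜ x) = ω ![p, x, y]) {w : V ⊗[k] V}
    (hw : w ∈ altTwo k V) :
    TensorProduct.dualDistrib k V V (e.coord 1 ⊗ₜ e.coord 2) w = θ (e 0) w := by
  refine eq_of_mem_altTwo (fun x y => ?_) hw
  rw [hθ, alternating_eq_det e, he]
  simp
  ring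

theorem dualDistrib_self_eq_zero (f : Module.Dual k V) {w : V ⊗[k] V} (hw : w ∈ altTwo k V) :
    TensorProduct.dualDistrib k V V (f ⊗ₜ f) w = 0 := by
  refine eq_of_mem_altTwo (g := 0) (fun x y => ?_) hw
  simp
  ring

theorem triple_assoc_tmul (f g h : Module.Dual k V) (w : V ⊗[k] V) (z : V) :
    TensorProduct.dualDistrib k V (V ⊗[k] V)
        (f ⊗ₜ TensorProduct.dualDistrib k V V (g ⊗ₜ h)) (TensorProduct.assoc k V V V (w ⊗ₜ z)) =
      TensorProduct.dualDistrib k V V (f ⊗ₜ g) w * h z := by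
  induction w with
  | zero => simp
  | tmul x y => simp [mul_assoc]
  | add a b ha hb => simp only [TensorProduct.add_tmul, map_add, ha, hb, add_mul]

theorem triple_op12_tmul {q : k} {N N' : V ⊗[k] V →ₗ[k] V ⊗[k] V} (hN : IsSkewPair k V q N N')
    (he : ω e = 1) (hθ : ∀ p x y, θ p (x ⊗ₜ y - y ⊗ₜ x) = ω ![p, x, y]) (x : V)
    {w : V ⊗[k] V} (hw : w ∈ altTwo k V) :
    TensorProduct.dualDistrib k V (V ⊗[k] V)
        (e.coord 1 ⊗ₜ TensorProduct.dualDistrib k V V (e.coord 2 ⊗ₜ e.coord 2))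
        (op12 k V N' (x ⊗ₜ w)) =
      θ (e 0) (N' (x ⊗ₜ e 1)) * θ (e 0) w - θ (e 0) (N' (x ⊗ₜ e 0)) * θ (e 1) w := by
  have hlin : ∀ a, θ (e 0) (N' (x ⊗ₜ a)) = e.coord 0 a * θ (e 0) (N' (x ⊗ₜ e 0)) +
      e.coord 1 a * θ (e 0) (N' (x ⊗ₜ e 1)) + e.coord 2 a * θ (e 0) (N' (x ⊗ₜ e 2)) := by
    intro a
    conv_lhs => rw [← e.sum_repr a]
    simp only [Fin.sum_univ_three, TensorProduct.tmul_add, TensorProduct.tmul_smul, map_add,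
      map_smul, smul_eq_mul, Module.Basis.coord_apply]
  have hmem : ∀ u, N' u ∈ altTwo k V := fun u => hN.range_right ▸ LinearMap.mem_range_self N' u
  refine eq_of_mem_altTwo
    (f := TensorProduct.dualDistrib k V (V ⊗[k] V)
        (e.coord 1 ⊗ₜ TensorProduct.dualDistrib k V V (e.coord 2 ⊗ₜ e.coord 2)) ∘ₗ
        op12 k V N' ∘ₗ TensorProduct.mk k V (V ⊗[k] V) x)
    (g := θ (e 0) (N' (x ⊗ₜ e 1)) • θ (e 0) - θ (e 0) (N' (x ⊗ₜ e 0)) • θ (e 1))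
    (fun a b => ?_) hw
  have h0 := hθ (e 0) a b
  have h1 := hθ (e 1) a b
  rw [map_sub, alternating_eq_det e, he] at h0 h1
  simp only [Module.Basis.coord_apply, Module.Basis.repr_self, Finsupp.single_apply] at h0 h1
  simp at h0 h1
  simp only [LinearMap.comp_apply, TensorProduct.mk_apply, map_sub, Module.Basis.coord_apply,
    op12_tmul, triple_assoc_tmul, dualDistrib_coord_eq he hθ (hmem _), LinearMap.sub_apply,
    LinearMap.smul_apply, smul_eq_mul, hlin a, hlin b]
  linear_combination θ (e 0) (N' (x ⊗ₜ e 0)) * h1 - θ (e 0) (N' (x ⊗ₜ e 1)) * h0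

/-- The quadratic relations between the components of `N` and `N'` forced by the braid
relation. -/
theorem quadratic_relation {q : k} {N N' : V ⊗[k] V →ₗ[k] V ⊗[k] V}
    (hN : IsSkewPair k V q N N') (he : ω e = 1)
    (hθ : ∀ p x y, θ p (x ⊗ₜ y - y ⊗ₜ x) = ω ![p, x, y]) (x y z : V) :
    θ (e 0) (N' (x ⊗ₜ e 1)) * θ (e 0) (N (y ⊗ₜ z))
        - θ (e 0) (N' (x ⊗ₜ e 0)) * θ (e 1) (N (y ⊗ₜ z))
        - (θ (e 0) (N' (y ⊗ₜ e 1)) * θ (e 0) (N (x ⊗ₜ z))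
        - θ (e 0) (N' (y ⊗ₜ e 0)) * θ (e 1) (N (x ⊗ₜ z))) =
      q * ω ![e 0, x, y] * e.coord 2 z := by
  have hmem : ∀ u, N u ∈ altTwo k V := fun u => hN.range_left ▸ LinearMap.mem_range_self N u
  obtain ⟨u, hu⟩ : x ⊗ₜ[k] y - y ⊗ₜ[k] x ∈ LinearMap.range N' :=
    hN.range_right ▸ tmul_sub_tmul_mem_altTwo x y
  have hzero : ∀ t, TensorProduct.dualDistrib k V (V ⊗[k] V)
      (e.coord 1 ⊗ₜ TensorProduct.dualDistrib k V V (e.coord 2 ⊗ₜ e.coord 2))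
      (op23 k V N t) = 0 := by
    intro t
    induction t with
    | zero => simp
    | tmul a w => simp [dualDistrib_self_eq_zero _ (hmem w)]
    | add a b ha hb => rw [map_add, map_add, ha, hb, add_zero]
  have hb := congrArg (TensorProduct.dualDistrib k V (V ⊗[k] V)
      (e.coord 1 ⊗ₜ TensorProduct.dualDistrib k V V (e.coord 2 ⊗ₜ e.coord 2)))
    (hN.braid (TensorProduct.assoc k V V V (u ⊗ₜ z)))
  rw [op12_assoc, hu, map_sub, map_sub, map_smul, map_smul, hzero, hzero, triple_assoc_tmul,
    dualDistrib_coord_eq he hθ (tmul_sub_tmul_mem_altTwo x y), hθ, TensorProduct.sub_tmul,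
    map_sub, TensorProduct.assoc_tmul, TensorProduct.assoc_tmul, map_sub, op23_tmul, op23_tmul,
    map_sub, map_sub, triple_op12_tmul hN he hθ _ (hmem _),
    triple_op12_tmul hN he hθ _ (hmem _)] at hb
  simp only [smul_eq_mul] at hb
  linear_combination hb

end Components

/-- If the components of `N` and `N'` are pointwise proportional, they are proportional. -/
theorem components_proportional (hdim : Module.finrank k V = 3) {q : k}
    {N N' : V ⊗[k] V →ₗ[k] V ⊗[k] V} (hN : IsSkewPair k V q N N')
    {ω : AlternatingMap k V k (Fin 3)} (hω : ω ≠ 0) {θ : V →ₗ[k] V ⊗[k] V →ₗ[k] k}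
    (hθ : ∀ p x y, θ p (x ⊗ₜ y - y ⊗ₜ x) = ω ![p, x, y])
    (h : ∀ p x u v, θ p (N (x ⊗ₜ u)) * θ p (N' (x ⊗ₜ v)) =
      θ p (N (x ⊗ₜ v)) * θ p (N' (x ⊗ₜ u))) :
    ∃ c : k, ∀ p w, θ p (N' w) = c * θ p (N w) := by
  have hne : ∀ p, p ≠ 0 → θ p ∘ₗ N ≠ 0 := by
    intro p hp hc
    obtain ⟨e, rfl, he⟩ := exists_basis_alternating_eq_one hdim hω hp
    obtain ⟨u, hu⟩ : e 1 ⊗ₜ[k] e 2 - e 2 ⊗ₜ[k] e 1 ∈ LinearMap.range N :=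
      hN.range_left ▸ tmul_sub_tmul_mem_altTwo _ _
    have := LinearMap.congr_fun hc u
    rw [LinearMap.comp_apply, hu, hθ, alternating_eq_det e, he] at this
    simp at this
  have hsymm : ∀ p x, θ p (N' (x ⊗ₜ p)) = θ p (N' (p ⊗ₜ x)) := by
    intro p x
    obtain ⟨u, hu⟩ : x ⊗ₜ[k] p - p ⊗ₜ[k] x ∈ LinearMap.range N' :=
      hN.range_right ▸ tmul_sub_tmul_mem_altTwo _ _
    have h1 := LinearMap.congr_fun hN.sq_right u
    rw [LinearMap.comp_apply, LinearMap.smul_apply, hu] at h1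
    have h2 := congrArg (θ p) h1
    rw [map_smul, hθ, map_sub, map_sub, ω.map_eq_zero_of_eq (i := 0) (j := 2) _ (by simp)
      (by decide), smul_zero] at h2
    exact sub_eq_zero.mp h2
  have hp : ∀ p, p ≠ 0 → ∃ c : k, θ p ∘ₗ N' = c • (θ p ∘ₗ N) := by
    intro p hp
    rcases proportional_or_common_line (TensorProduct.curry (θ p ∘ₗ N))
      (TensorProduct.curry (θ p ∘ₗ N')) (fun x u v => h p x u v)
      (fun hc => hne p hp (TensorProduct.ext' fun x y =>
        LinearMap.congr_fun (LinearMap.congr_fun hc x) y)) with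
      ⟨c, hc⟩ | ⟨f, α, β, hα, hβ⟩
    · refine ⟨c, TensorProduct.ext' fun x y => ?_⟩
      exact LinearMap.congr_fun (LinearMap.congr_fun hc x) y
    · exfalso
      obtain ⟨e, rfl, he⟩ := exists_basis_alternating_eq_one hdim hω hp
      have hα' : ∀ x y, θ (e 0) (N (x ⊗ₜ y)) = α x * f y :=
        fun x y => LinearMap.congr_fun (hα x) y
      have hβ' : ∀ x y, θ (e 0) (N' (x ⊗ₜ y)) = β x * f y :=
        fun x y => LinearMap.congr_fun (hβ x) y
      have key := quadratic_relation hN he hθ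
      simp only [hα', hβ'] at key
      have hq := hN.ne_zero
      by_cases hf : f (e 0) = 0
      · have h1 := key (e 1) (e 2) (e 1)
        have h2 := key (e 1) (e 2) (e 2)
        simp [hf, alternating_eq_det e, he] at h1 h2
        have h3 : (β (e 1) * α (e 2) - β (e 2) * α (e 1)) * f (e 1) * f (e 1) = 0 := by
          linear_combination h1
        have h4 : (β (e 1) * α (e 2) - β (e 2) * α (e 1)) * f (e 1) = 0 := by
          rcases mul_eq_zero.mp h3 with h | h
          · exact h
          · rw [h, mul_zero]
        exact hq (by linear_combination -h2 + f (e 2) * h4)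
      · have hs := hsymm (e 0)
        simp only [hβ'] at hs
        have hz : ∀ x, f x = 0 → β x = 0 := by
          intro x hx
          have := hs x
          rw [hx, mul_zero] at this
          exact (mul_eq_zero.mp this).resolve_right hf
        have h0 : ∀ i, f (e i - (f (e i) / f (e 0)) • e 0) = 0 := by
          intro i
          rw [map_sub, map_smul, smul_eq_mul, div_mul_cancel₀ _ hf, sub_self]
        have h1 := key (e 1 - (f (e 1) / f (e 0)) • e 0) (e 2 - (f (e 2) / f (e 0)) • e 0) (e 2)
        rw [hz _ (h0 1), hz _ (h0 2), alternating_eq_det e, he] at h1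
        simp at h1
        exact hq h1.symm
  obtain ⟨p₀, hp₀⟩ : ∃ p : V, p ≠ 0 := by
    have : Nontrivial V := Module.nontrivial_of_finrank_pos (R := k) (by omega)
    exact exists_ne 0
  obtain ⟨c, hc⟩ := hp p₀ hp₀
  refine ⟨c, fun y w => ?_⟩
  have hc' : ∀ w, θ p₀ (N' w) = c * θ p₀ (N w) := fun w => LinearMap.congr_fun hc w
  by_cases hy : y = 0
  · simp [hy]
  obtain ⟨d, hd⟩ := hp y hy
  have hd' : ∀ w, θ y (N' w) = d * θ y (N w) := fun w => LinearMap.congr_fun hd w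
  by_cases hs : y + p₀ = 0
  · rw [eq_neg_of_add_eq_zero_left hs]
    simp [hc']
  obtain ⟨b, hb⟩ := hp _ hs
  have hb' : ∀ w, θ y (N' w) + θ p₀ (N' w) = b * (θ y (N w) + θ p₀ (N w)) := by
    intro w
    simpa using LinearMap.congr_fun hb w
  have hv : (d - b) • y + (c - b) • p₀ = 0 := by
    by_contra hc0
    refine hne _ hc0 (LinearMap.ext fun w => ?_)
    have := hb' w
    rw [hc', hd'] at this
    simp only [LinearMap.comp_apply, map_add, map_smul, LinearMap.add_apply, LinearMap.smul_apply,
      smul_eq_mul, LinearMap.zero_apply]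
    linear_combination this
  by_cases hdb : d = b
  · rw [hdb, sub_self, zero_smul, zero_add] at hv
    rcases smul_eq_zero.mp hv with h1 | h1
    · rw [hd', hdb, sub_eq_zero.mp h1]
    · exact absurd h1 hp₀
  · have hy' : y = ((d - b)⁻¹ * (b - c)) • p₀ := by
      rw [mul_smul, eq_inv_smul_iff₀ (sub_ne_zero.mpr hdb), eq_comm, ← sub_eq_zero, ← neg_eq_zero,
        ← hv]
      module
    rw [hy']
    simp [hc']
    ring

/-- The reversal `x ⊗ (y ⊗ z) ↦ z ⊗ (y ⊗ x)`. -/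
def reversal (k V : Type) [Field k] [AddCommGroup V] [Module k V] :
    V ⊗[k] (V ⊗[k] V) →ₗ[k] V ⊗[k] (V ⊗[k] V) :=
  LinearMap.lTensor V (TensorProduct.comm k V V).toLinearMap ∘ₗ
    (TensorProduct.comm k (V ⊗[k] V) V).toLinearMap ∘ₗ
      (TensorProduct.assoc k V V V).symm.toLinearMap

theorem reversal_tmul (x y z : V) :
    reversal k V (x ⊗ₜ (y ⊗ₜ z)) = z ⊗ₜ (y ⊗ₜ x) := by
  simp [reversal]

theorem reversal_assoc_tmul (w : V ⊗[k] V) (z : V) :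
    reversal k V (TensorProduct.assoc k V V V (w ⊗ₜ z)) =
      z ⊗ₜ TensorProduct.comm k V V w := by
  simp [reversal]

theorem reversal_reversal (t : V ⊗[k] (V ⊗[k] V)) : reversal k V (reversal k V t) = t := by
  have : reversal k V ∘ₗ reversal k V = LinearMap.id := by
    ext x y z
    simp [reversal_tmul]
  exact LinearMap.congr_fun this t

section Flip

variable {N : V ⊗[k] V →ₗ[k] V ⊗[k] V}

theorem comm_of_mem_altTwo {w : V ⊗[k] V} (hw : w ∈ altTwo k V) :
    TensorProduct.comm k V V w = -w := by
  refine eq_of_mem_altTwo (f := (TensorProduct.comm k V V).toLinearMap) (g := -LinearMap.id)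
    (fun x y => ?_) hw
  simp

theorem reversal_op12 (hr : ∀ w, N w ∈ altTwo k V) (hs : ∀ x y, N (x ⊗ₜ y) = N (y ⊗ₜ x))
    (t : V ⊗[k] (V ⊗[k] V)) :
    reversal k V (op12 k V N t) = -op23 k V N (reversal k V t) := by
  have : reversal k V ∘ₗ op12 k V N = -(op23 k V N ∘ₗ reversal k V) := by
    refine TensorProduct.ext_threefold' ?_
    intro x y z
    simp [reversal_tmul, reversal_assoc_tmul, comm_of_mem_altTwo (hr _), hs x y,
      TensorProduct.tmul_neg]
  exact LinearMap.congr_fun this t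

theorem reversal_op23 (hr : ∀ w, N w ∈ altTwo k V) (hs : ∀ x y, N (x ⊗ₜ y) = N (y ⊗ₜ x))
    (t : V ⊗[k] (V ⊗[k] V)) :
    reversal k V (op23 k V N t) = -op12 k V N (reversal k V t) := by
  have h := reversal_op12 hr hs (reversal k V t)
  rw [reversal_reversal] at h
  rw [← neg_eq_iff_eq_neg.mpr h, map_neg, reversal_reversal]

theorem op12_op12_comm (hs : ∀ x y, N (x ⊗ₜ y) = N (y ⊗ₜ x)) (t : V ⊗[k] (V ⊗[k] V)) :
    op12 k V N (op12 k V (TensorProduct.comm k V V).toLinearMap t) = op12 k V N t := by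
  have : op12 k V N ∘ₗ op12 k V (TensorProduct.comm k V V).toLinearMap = op12 k V N := by
    refine TensorProduct.ext_threefold' fun x y z => ?_
    simp [hs x y]
  exact LinearMap.congr_fun this t

theorem op23_op23_comm (hs : ∀ x y, N (x ⊗ₜ y) = N (y ⊗ₜ x)) (t : V ⊗[k] (V ⊗[k] V)) :
    op23 k V N (op23 k V (TensorProduct.comm k V V).toLinearMap t) = op23 k V N t := by
  have : op23 k V N ∘ₗ op23 k V (TensorProduct.comm k V V).toLinearMap = op23 k V N := by
    refine TensorProduct.ext_threefold' fun x y z => ?_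
    simp [hs y z]
  exact LinearMap.congr_fun this t

theorem op12_comm_op12 (hr : ∀ w, N w ∈ altTwo k V) (t : V ⊗[k] (V ⊗[k] V)) :
    op12 k V (TensorProduct.comm k V V).toLinearMap (op12 k V N t) = -op12 k V N t := by
  have : op12 k V (TensorProduct.comm k V V).toLinearMap ∘ₗ op12 k V N = -op12 k V N := by
    refine TensorProduct.ext_threefold' fun x y z => ?_
    simp [comm_of_mem_altTwo (hr _), TensorProduct.neg_tmul]
  exact LinearMap.congr_fun this t

theorem op23_comm_op23 (hr : ∀ w, N w ∈ altTwo k V) (t : V ⊗[k] (V ⊗[k] V)) :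
    op23 k V (TensorProduct.comm k V V).toLinearMap (op23 k V N t) = -op23 k V N t := by
  have : op23 k V (TensorProduct.comm k V V).toLinearMap ∘ₗ op23 k V N = -op23 k V N := by
    refine TensorProduct.ext_threefold' fun x y z => ?_
    simp [comm_of_mem_altTwo (hr _), TensorProduct.tmul_neg]
  exact LinearMap.congr_fun this t

end Flip

theorem reversal_eq (t : V ⊗[k] (V ⊗[k] V)) :
    reversal k V t = op12 k V (TensorProduct.comm k V V).toLinearMap
      (op23 k V (TensorProduct.comm k V V).toLinearMap
        (op12 k V (TensorProduct.comm k V V).toLinearMap t)) := by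
  have : reversal k V = op12 k V (TensorProduct.comm k V V).toLinearMap ∘ₗ
      op23 k V (TensorProduct.comm k V V).toLinearMap ∘ₗ
        op12 k V (TensorProduct.comm k V V).toLinearMap := by
    refine TensorProduct.ext_threefold' fun x y z => ?_
    simp [reversal_tmul]
  exact LinearMap.congr_fun this t

theorem op12_smul (c : k) (N : V ⊗[k] V →ₗ[k] V ⊗[k] V) (t : V ⊗[k] (V ⊗[k] V)) :
    op12 k V (c • N) t = c • op12 k V N t := by
  simp [op12, LinearMap.rTensor_smul]

/-- The components of a skew pair are proportional only if they are equal. -/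
theorem IsSkewPair.eq_one_of_smul (hdim : Module.finrank k V = 3) {q c : k}
    {N : V ⊗[k] V →ₗ[k] V ⊗[k] V} (hN : IsSkewPair k V q N (c • N)) : c = 1 := by
  have hr : ∀ w, N w ∈ altTwo k V := fun w => hN.range_left ▸ LinearMap.mem_range_self N w
  have hsurj : ∀ x y, ∃ u, N u = x ⊗ₜ[k] y - y ⊗ₜ[k] x := fun x y =>
    (hN.range_left ▸ tmul_sub_tmul_mem_altTwo x y : x ⊗ₜ[k] y - y ⊗ₜ[k] x ∈ LinearMap.range N)
  have hsurj' : ∀ x y, ∃ u, c • N u = x ⊗ₜ[k] y - y ⊗ₜ[k] x := fun x y =>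
    (hN.range_right ▸ tmul_sub_tmul_mem_altTwo x y :
      x ⊗ₜ[k] y - y ⊗ₜ[k] x ∈ LinearMap.range (c • N))
  have hNalt : ∀ x y, N (x ⊗ₜ y - y ⊗ₜ x) = (1 + q) • (x ⊗ₜ[k] y - y ⊗ₜ[k] x) := by
    intro x y
    obtain ⟨u, hu⟩ := hsurj x y
    rw [← hu]
    exact LinearMap.congr_fun hN.sq_left u
  have hNalt' : ∀ x y, c • N (x ⊗ₜ y - y ⊗ₜ x) = (1 + q) • (x ⊗ₜ[k] y - y ⊗ₜ[k] x) := by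
    intro x y
    obtain ⟨u, hu⟩ := hsurj' x y
    rw [← hu]
    exact LinearMap.congr_fun hN.sq_right u
  have : Module.Finite k V := Module.finite_of_finrank_eq_succ hdim
  let e := Module.finBasisOfFinrankEq k V hdim
  by_cases hq : 1 + q = 0
  · have hs : ∀ x y, N (x ⊗ₜ y) = N (y ⊗ₜ x) := by
      intro x y
      rw [← sub_eq_zero, ← map_sub, hNalt, hq, zero_smul]
    have hA : ∀ t, c • (c • op12 k V N (op23 k V N (op12 k V N t))) - q • c • op12 k V N t =
        c • op23 k V N (op12 k V N (op23 k V N t)) - q • op23 k V N t := by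
      intro t
      simpa only [op12_smul, map_smul] using hN.braid t
    set A : V ⊗[k] (V ⊗[k] V) → V ⊗[k] (V ⊗[k] V) := fun t =>
      c • op23 k V N (op12 k V N (op23 k V N t)) - q • op23 k V N t with hAdef
    have hA12 : ∀ t, A t = c • (c • op12 k V N (op23 k V N (op12 k V N t))) -
        q • c • op12 k V N t := fun t => (hA t).symm
    have hR12 : ∀ t, A (op12 k V (TensorProduct.comm k V V).toLinearMap t) = A t := by
      intro t
      rw [hA12, hA12, op12_op12_comm hs]
    have hR23 : ∀ t, A (op23 k V (TensorProduct.comm k V V).toLinearMap t) = A t := by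
      intro t
      simp only [hAdef, op23_op23_comm hs]
    have hL12 : ∀ t, op12 k V (TensorProduct.comm k V V).toLinearMap (A t) = -A t := by
      intro t
      rw [hA12]
      simp only [map_sub, map_smul, op12_comm_op12 hr]
      module
    have hL23 : ∀ t, op23 k V (TensorProduct.comm k V V).toLinearMap (A t) = -A t := by
      intro t
      simp only [hAdef, map_sub, map_smul, op23_comm_op23 hr]
      module
    have hcA : ∀ t, c • A t = A t := by
      intro t
      have h1 : reversal k V (A (reversal k V t)) = -A t := by
        rw [reversal_eq t, hR12, hR23, hR12, reversal_eq]
        simp only [hL12, hL23, map_neg, neg_neg]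
      rw [hA12] at h1
      simp only [map_sub, map_smul, reversal_op12 hr hs, reversal_op23 hr hs, map_neg,
        reversal_reversal] at h1
      rw [← neg_inj, ← h1]
      simp only [hAdef]
      module
    obtain ⟨u₀, hu₀⟩ := hsurj (e 1) (e 2)
    obtain ⟨u₁, hu₁⟩ := hsurj (e 2) (e 0)
    obtain ⟨u₂, hu₂⟩ := hsurj (e 0) (e 1)
    set u := TensorProduct.assoc k V V V (u₀ ⊗ₜ e 0) + TensorProduct.assoc k V V V (u₁ ⊗ₜ e 1) +
      TensorProduct.assoc k V V V (u₂ ⊗ₜ e 2) with hu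
    have hAu : A u = -(q * c) • op12 k V N u := by
      have h0 : op23 k V N (op12 k V N u) = 0 := by
        simp only [hu, map_add, op12_assoc, hu₀, hu₁, hu₂, TensorProduct.sub_tmul, map_sub,
          TensorProduct.assoc_tmul, op23_tmul, hs (e 1) (e 0), hs (e 2) (e 0), hs (e 2) (e 1)]
        abel
      rw [hA12, h0, map_zero]
      module
    have hu_ne : op12 k V N u ≠ 0 := by
      intro h0
      have h1 := congrArg (TensorProduct.dualDistrib k V (V ⊗[k] V)
        (e.coord 0 ⊗ₜ TensorProduct.dualDistrib k V V (e.coord 1 ⊗ₜ e.coord 2))) h0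
      simp [hu, hu₀, hu₁, hu₂, TensorProduct.sub_tmul] at h1
    have hc : c ≠ 0 := by
      rintro rfl
      obtain ⟨v, hv⟩ := hsurj' (e 0) (e 1)
      have h1 := congrArg (TensorProduct.dualDistrib k V V (e.coord 0 ⊗ₜ e.coord 1)) hv
      simp at h1
    have h1 := hcA u
    rw [hAu, ← sub_eq_zero, smul_smul, ← sub_smul] at h1
    have h2 := (smul_eq_zero.mp h1).resolve_right hu_ne
    refine mul_left_cancel₀ (mul_ne_zero hN.ne_zero hc) ?_
    linear_combination -h2
  · have h1 := hNalt' (e 0) (e 1)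
    rw [hNalt] at h1
    have h2 := congrArg (TensorProduct.dualDistrib k V V (e.coord 0 ⊗ₜ e.coord 1)) h1
    simp at h2
    exact mul_right_cancel₀ hq (h2.trans (one_mul _).symm)

/-- The conjugate of an operator on `V ⊗ V` by `ζ ⊗ Id`. -/
def untwist (ζ : V ≃ₗ[k] V) (Y : V ⊗[k] V →ₗ[k] V ⊗[k] V) : V ⊗[k] V →ₗ[k] V ⊗[k] V :=
  (TensorProduct.congr ζ (LinearEquiv.refl k V)).symm.toLinearMap ∘ₗ Y ∘ₗ
    (TensorProduct.congr ζ (LinearEquiv.refl k V)).toLinearMap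

theorem congr_untwist (ζ : V ≃ₗ[k] V) (Y : V ⊗[k] V →ₗ[k] V ⊗[k] V) (w : V ⊗[k] V) :
    TensorProduct.congr ζ (LinearEquiv.refl k V) (untwist ζ Y w) =
      Y (TensorProduct.congr ζ (LinearEquiv.refl k V) w) := by
  simp only [untwist, LinearMap.comp_apply, LinearEquiv.coe_coe, LinearEquiv.apply_symm_apply]

theorem map_id_untwist (ζ : V ≃ₗ[k] V) (Y : V ⊗[k] V →ₗ[k] V ⊗[k] V) (w : V ⊗[k] V) :
    TensorProduct.map ζ.toLinearMap LinearMap.id (untwist ζ Y w) =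
      Y (TensorProduct.map ζ.toLinearMap LinearMap.id w) :=
  congr_untwist ζ Y w

theorem untwist_injective (ζ : V ≃ₗ[k] V) :
    Function.Injective (untwist ζ : (V ⊗[k] V →ₗ[k] V ⊗[k] V) → _) := by
  intro Y Y' h
  refine LinearMap.ext fun w => ?_
  obtain ⟨v, rfl⟩ := (TensorProduct.congr ζ (LinearEquiv.refl k V)).surjective w
  rw [← congr_untwist, ← congr_untwist, h]

theorem untwist_smul (ζ : V ≃ₗ[k] V) (c : k) (Y : V ⊗[k] V →ₗ[k] V ⊗[k] V) :
    untwist ζ (c • Y) = c • untwist ζ Y := by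
  simp [untwist, LinearMap.smul_comp, LinearMap.comp_smul]

theorem range_untwist {ζ : V ≃ₗ[k] V} {Y : V ⊗[k] V →ₗ[k] V ⊗[k] V}
    (hY : LinearMap.range Y = Ups2 k V ζ) : LinearMap.range (untwist ζ Y) = altTwo k V := by
  rw [untwist, LinearMap.range_comp, LinearMap.range_comp_of_range_eq_top _
    (LinearEquiv.range _), hY, Ups2, Submodule.map_span, altTwo]
  congr 1
  ext w
  constructor
  · rintro ⟨_, ⟨x, y, rfl⟩, rfl⟩
    exact ⟨x, y, by simp [wedge2]⟩
  · rintro ⟨x, y, rfl⟩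
    exact ⟨wedge2 k V ζ x y, ⟨x, y, rfl⟩, by simp [wedge2]⟩

theorem sq_untwist {ζ : V ≃ₗ[k] V} {a : k} {Y : V ⊗[k] V →ₗ[k] V ⊗[k] V}
    (hY : Y ∘ₗ Y = a • Y) : untwist ζ Y ∘ₗ untwist ζ Y = a • untwist ζ Y := by
  rw [← untwist_smul, ← hY]
  refine LinearMap.ext fun w => ?_
  simp only [untwist, LinearMap.comp_apply, LinearEquiv.coe_coe, LinearEquiv.apply_symm_apply]

theorem skewY_Rprime (ζ : V ≃ₗ[k] V) (q : k) (R : V ⊗[k] V →ₗ[k] V ⊗[k] V) :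
    skewY k V q (Rprime k V ζ R) = Rprime k V ζ (skewY k V q R) := by
  ext x y
  simp [skewY, Rprime]

theorem sq_skewY {q : k} {R : V ⊗[k] V →ₗ[k] V ⊗[k] V} (hR : IsHeckeSymmetry k V q R) :
    skewY k V q R ∘ₗ skewY k V q R = (1 + q) • skewY k V q R := by
  refine LinearMap.ext fun w => ?_
  have h := LinearMap.congr_fun hR.2.2 w
  simp only [LinearMap.comp_apply, LinearMap.sub_apply, LinearMap.add_apply, LinearMap.smul_apply,
    LinearMap.id_apply, map_add, LinearMap.zero_apply, skewY, map_sub, map_smul] at h ⊢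
  rw [← sub_eq_zero, ← h]
  module

theorem braid_skewY {q : k} {R : V ⊗[k] V →ₗ[k] V ⊗[k] V} (hR : IsHeckeSymmetry k V q R)
    (t : V ⊗[k] (V ⊗[k] V)) :
    op12 k V (skewY k V q R) (op23 k V (skewY k V q R) (op12 k V (skewY k V q R) t)) -
        q • op12 k V (skewY k V q R) t =
      op23 k V (skewY k V q R) (op12 k V (skewY k V q R) (op23 k V (skewY k V q R) t)) -
        q • op23 k V (skewY k V q R) t := by
  have h12 : ∀ t, op12 k V (skewY k V q R) t = q • t - op12 k V R t := by
    intro t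
    simp [skewY, op12]
  have h23 : ∀ t, op23 k V (skewY k V q R) t = q • t - op23 k V R t := by
    intro t
    simp [skewY, op23]
  have hRR : R ∘ₗ R = (q - 1) • R + q • LinearMap.id := by
    refine LinearMap.ext fun w => ?_
    have h := LinearMap.congr_fun hR.2.2 w
    simp only [LinearMap.comp_apply, LinearMap.sub_apply, LinearMap.add_apply,
      LinearMap.smul_apply, LinearMap.id_apply, map_add, LinearMap.zero_apply] at h ⊢
    rw [← sub_eq_zero, ← h]
    module
  have s12 : ∀ t, op12 k V R (op12 k V R t) = (q - 1) • op12 k V R t + q • t := by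
    intro t
    have : op12 k V R ∘ₗ op12 k V R = (q - 1) • op12 k V R + q • LinearMap.id := by
      refine TensorProduct.ext_threefold' fun x y z => ?_
      have := LinearMap.congr_fun hRR (x ⊗ₜ y)
      simp only [LinearMap.comp_apply] at this
      simp [this, TensorProduct.add_tmul, ← TensorProduct.smul_tmul']
    exact LinearMap.congr_fun this t
  have s23 : ∀ t, op23 k V R (op23 k V R t) = (q - 1) • op23 k V R t + q • t := by
    intro t
    have : op23 k V R ∘ₗ op23 k V R = (q - 1) • op23 k V R + q • LinearMap.id := by
      refine TensorProduct.ext_threefold' fun x y z => ?_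
      have := LinearMap.congr_fun hRR (y ⊗ₜ z)
      simp only [LinearMap.comp_apply] at this
      simp [this, TensorProduct.tmul_add]
    exact LinearMap.congr_fun this t
  have hb := LinearMap.congr_fun hR.2.1 t
  simp only [LinearMap.comp_apply] at hb
  simp only [h12, h23, map_sub, map_smul, s12, s23, hb]
  module

theorem range_Rprime {ζ : V ≃ₗ[k] V} {Y : V ⊗[k] V →ₗ[k] V ⊗[k] V}
    (hY : LinearMap.range Y = Ups2 k V ζ) :
    LinearMap.range (Rprime k V ζ Y) = Ups2 k V ζ := by
  have hs : LinearMap.range (TensorProduct.map ζ.toLinearMap ζ.toLinearMap) = ⊤ :=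
    LinearMap.range_eq_top.mpr (TensorProduct.map_surjective ζ.surjective ζ.surjective)
  rw [Rprime, LinearMap.range_comp, LinearMap.range_comp_of_range_eq_top _ hs, hY, Ups2,
    Submodule.map_span]
  congr 1
  ext w
  constructor
  · rintro ⟨_, ⟨x, y, rfl⟩, rfl⟩
    exact ⟨ζ.symm x, ζ.symm y, by simp [wedge2]⟩
  · rintro ⟨x, y, rfl⟩
    exact ⟨wedge2 k V ζ (ζ x) (ζ y), ⟨ζ x, ζ y, rfl⟩, by simp [wedge2]⟩

theorem map_Rprime (ζ : V ≃ₗ[k] V) (Y : V ⊗[k] V →ₗ[k] V ⊗[k] V) (w : V ⊗[k] V) :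
    TensorProduct.map ζ.toLinearMap ζ.toLinearMap (Rprime k V ζ Y w) =
      Y (TensorProduct.map ζ.toLinearMap ζ.toLinearMap w) := by
  simp only [Rprime, LinearMap.comp_apply]
  rw [← LinearMap.comp_apply, ← TensorProduct.map_comp]
  simp

theorem sq_Rprime {ζ : V ≃ₗ[k] V} {a : k} {Y : V ⊗[k] V →ₗ[k] V ⊗[k] V}
    (hY : Y ∘ₗ Y = a • Y) : Rprime k V ζ Y ∘ₗ Rprime k V ζ Y = a • Rprime k V ζ Y := by
  refine LinearMap.ext fun w => ?_
  have h := LinearMap.congr_fun hY (TensorProduct.map ζ.toLinearMap ζ.toLinearMap w)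
  rw [LinearMap.comp_apply, LinearMap.smul_apply] at h
  change TensorProduct.map ζ.symm.toLinearMap ζ.symm.toLinearMap
    (Y (TensorProduct.map ζ.toLinearMap ζ.toLinearMap (Rprime k V ζ Y w))) = _
  rw [map_Rprime, h, map_smul]
  rfl

/-- The untwisted skewsymmetrizers of `R` and `R'` form a skew pair. -/
theorem isSkewPair_untwist {ζ : V ≃ₗ[k] V} {q : k} {R : V ⊗[k] V →ₗ[k] V ⊗[k] V}
    (hR : IsHeckeSymmetry k V q R) (hY : LinearMap.range (skewY k V q R) = Ups2 k V ζ) :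
    IsSkewPair k V q (untwist ζ (skewY k V q R))
      (untwist ζ (skewY k V q (Rprime k V ζ R))) := by
  rw [skewY_Rprime]
  refine ⟨hR.1, range_untwist hY, range_untwist (range_Rprime hY), sq_untwist (sq_skewY hR),
    sq_untwist (sq_Rprime (sq_skewY hR)), fun t => ?_⟩
  set Y := skewY k V q R with hYdef
  let J : V ⊗[k] (V ⊗[k] V) ≃ₗ[k] V ⊗[k] (V ⊗[k] V) :=
    TensorProduct.congr (ζ.trans ζ) (TensorProduct.congr ζ (LinearEquiv.refl k V))
  have h23 : ∀ t, J (op23 k V (untwist ζ Y) t) = op23 k V Y (J t) := by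
    intro t
    have : J.toLinearMap ∘ₗ op23 k V (untwist ζ Y) = op23 k V Y ∘ₗ J.toLinearMap := by
      refine TensorProduct.ext_threefold' fun x y z => ?_
      simp [J, map_id_untwist]
    exact LinearMap.congr_fun this t
  have hJ : ∀ (w : V ⊗[k] V) (z : V), J (TensorProduct.assoc k V V V (w ⊗ₜ z)) =
      TensorProduct.assoc k V V V (TensorProduct.map ζ.toLinearMap ζ.toLinearMap
        (TensorProduct.congr ζ (LinearEquiv.refl k V) w) ⊗ₜ z) := by
    intro w z
    induction w with
    | zero => simp
    | tmul x y => simp [J]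
    | add a b ha hb => simp only [TensorProduct.add_tmul, map_add, ha, hb]
  have h12 : ∀ t, J (op12 k V (untwist ζ (Rprime k V ζ Y)) t) = op12 k V Y (J t) := by
    intro t
    have : J.toLinearMap ∘ₗ op12 k V (untwist ζ (Rprime k V ζ Y)) =
        op12 k V Y ∘ₗ J.toLinearMap := by
      refine TensorProduct.ext_threefold' fun x y z => ?_
      simp only [LinearMap.comp_apply, LinearEquiv.coe_coe, op12_tmul, hJ, congr_untwist,
        map_Rprime]
      simp [J]
    exact LinearMap.congr_fun this t
  apply J.injective
  simp only [map_sub, map_smul, h12, h23]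
  exact braid_skewY hR (J t)

/-- The pairing `(x, w) ↦ ω̃(x ⋏ w)`, untwisted in the second argument. -/
def wedgePairing (ζ : V ≃ₗ[k] V) (Ω : V ⊗[k] (V ⊗[k] V) →ₗ[k] k) : V →ₗ[k] V ⊗[k] V →ₗ[k] k where
  toFun x := Ω ∘ₗ wedge31 k V ζ x ∘ₗ (TensorProduct.congr ζ (LinearEquiv.refl k V)).toLinearMap
  map_add' x y := by
    ext a b
    simp [wedge31, TensorProduct.tmul_add]
    ring
  map_smul' c x := by
    ext a b
    simp [wedge31]
    ring

theorem wedgePairing_tmul_sub {ζ : V ≃ₗ[k] V} {Ω : V ⊗[k] (V ⊗[k] V) →ₗ[k] k}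
    {ω : AlternatingMap k V k (Fin 3)}
    (hΩ : ∀ x y z : V, Ω (wedge3 k V ζ x y z) = ω ![x, y, z]) (p x y : V) :
    wedgePairing ζ Ω p (x ⊗ₜ y - y ⊗ₜ x) = ω ![p, x, y] := by
  rw [← hΩ]
  simp [wedgePairing, wedge31, wedge3, TensorProduct.tmul_sub]
  ring

theorem ell_eq_wedgePairing (ζ : V ≃ₗ[k] V) (Y : V ⊗[k] V →ₗ[k] V ⊗[k] V)
    (Ω : V ⊗[k] (V ⊗[k] V) →ₗ[k] k) (x y z : V) :
    ell k V ζ Y Ω x y z = wedgePairing ζ Ω x (untwist ζ Y (y ⊗ₜ z)) := by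
  simp [ell, wedgePairing, map_id_untwist]

/-- The pairing with all vectors separates alternating tensors. -/
theorem eq_zero_of_wedgePairing_eq_zero (hdim : Module.finrank k V = 3)
    {ω : AlternatingMap k V k (Fin 3)} (hω : ω ≠ 0) {θ : V →ₗ[k] V ⊗[k] V →ₗ[k] k}
    (hθ : ∀ p x y, θ p (x ⊗ₜ y - y ⊗ₜ x) = ω ![p, x, y]) {w : V ⊗[k] V}
    (hw : w ∈ altTwo k V) (h : ∀ p, θ p w = 0) : w = 0 := by
  obtain ⟨p, hp⟩ : ∃ p : V, p ≠ 0 := by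
    have : Nontrivial V := Module.nontrivial_of_finrank_pos (R := k) (by omega)
    exact exists_ne 0
  obtain ⟨e, -, he⟩ := exists_basis_alternating_eq_one hdim hω hp
  have key : w = θ (e 0) w • (e 1 ⊗ₜ[k] e 2 - e 2 ⊗ₜ[k] e 1) +
      θ (e 1) w • (e 2 ⊗ₜ[k] e 0 - e 0 ⊗ₜ[k] e 2) +
      θ (e 2) w • (e 0 ⊗ₜ[k] e 1 - e 1 ⊗ₜ[k] e 0) := by
    refine eq_of_mem_altTwo (f := LinearMap.id)
      (g := (θ (e 0)).smulRight (e 1 ⊗ₜ[k] e 2 - e 2 ⊗ₜ[k] e 1) +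
        (θ (e 1)).smulRight (e 2 ⊗ₜ[k] e 0 - e 0 ⊗ₜ[k] e 2) +
        (θ (e 2)).smulRight (e 0 ⊗ₜ[k] e 1 - e 1 ⊗ₜ[k] e 0)) (fun x y => ?_) hw
    simp only [LinearMap.add_apply, LinearMap.smulRight_apply, hθ, alternating_eq_det e, he]
    conv_lhs => rw [← e.sum_repr x, ← e.sum_repr y]
    simp only [Fin.sum_univ_three, TensorProduct.tmul_add, TensorProduct.add_tmul,
      TensorProduct.tmul_smul, ← TensorProduct.smul_tmul', LinearMap.id_apply]
    simp
    module
  rw [key, h, h, h]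
  simp

end

theorem stmt7 (hdim : Module.finrank k V = 3) (ζ : V ≃ₗ[k] V) (q : k)
    (R : V ⊗[k] V →ₗ[k] V ⊗[k] V) (hR : IsHeckeSymmetry k V q R)
    (hY : LinearMap.range (skewY k V q R) = Ups2 k V ζ)
    (ω : AlternatingMap k V k (Fin 3)) (hω : ω ≠ 0)
    (Ω : V ⊗[k] (V ⊗[k] V) →ₗ[k] k)
    (hΩ : ∀ x y z : V, Ω (wedge3 k V ζ x y z) = ω ![x, y, z]) :
    [ -- (i) R commutes with ζ ⊗ ζ
      TensorProduct.map ζ.toLinearMap ζ.toLinearMap ∘ₗ R =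
        R ∘ₗ TensorProduct.map ζ.toLinearMap ζ.toLinearMap,
      -- (ii) Y' = Y
      skewY k V q (Rprime k V ζ R) = skewY k V q R,
      -- (iii) Y' = c • Y for some c
      ∃ c : k, skewY k V q (Rprime k V ζ R) = c • skewY k V q R,
      -- (iv) ℓ' = c • ℓ for some c
      ∃ c : k, ∀ x y : V, ellF' k V ζ q R Ω x y = c • ellF k V ζ q R Ω x y,
      -- (v) ℓ_{xy} ∧ ℓ'_{xy} = 0
      ∀ x y u v : V,
        ellF k V ζ q R Ω x y u * ellF' k V ζ q R Ω x y v =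
          ellF k V ζ q R Ω x y v * ellF' k V ζ q R Ω x y u ].TFAE := by
  have hP := isSkewPair_untwist hR hY
  have hθ := wedgePairing_tmul_sub hΩ
  tfae_have 1 ↔ 2 := by
    constructor
    · intro h
      rw [skewY, skewY, Rprime, ← h, ← LinearMap.comp_assoc, ← TensorProduct.map_comp]
      simp
    · intro h
      have h' : Rprime k V ζ R = R := sub_right_injective h
      refine LinearMap.ext fun w => ?_
      conv_lhs => rw [← h', LinearMap.comp_apply, map_Rprime]
      rfl
  tfae_have 2 → 3 := fun h => ⟨1, by rw [h, one_smul]⟩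
  tfae_have 3 → 2 := by
    rintro ⟨c, hc⟩
    rw [hc, untwist_smul] at hP
    rw [hc, hP.eq_one_of_smul hdim, one_smul]
  tfae_have 3 → 4 := by
    rintro ⟨c, hc⟩
    refine ⟨c, fun x y => LinearMap.ext fun z => ?_⟩
    simp [ellF, ellF', hc, ell]
  tfae_have 4 → 5 := by
    rintro ⟨c, hc⟩ x y u v
    rw [hc]
    simp only [LinearMap.smul_apply, smul_eq_mul]
    ring
  tfae_have 5 → 3 := by
    intro h
    simp only [ellF, ellF', ell_eq_wedgePairing] at h
    obtain ⟨c, hc⟩ := components_proportional hdim hP hω hθ h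
    refine ⟨c, untwist_injective ζ (LinearMap.ext fun w => sub_eq_zero.mp ?_)⟩
    rw [untwist_smul]
    refine eq_zero_of_wedgePairing_eq_zero hdim hω hθ (Submodule.sub_mem _ ?_ ?_) fun p => ?_
    · exact hP.range_right ▸ LinearMap.mem_range_self _ w
    · exact Submodule.smul_mem _ _ (hP.range_left ▸ LinearMap.mem_range_self _ w)
    · rw [map_sub, LinearMap.smul_apply, map_smul, hc, smul_eq_mul, sub_self]
  tfae_finish
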